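/- arXiv:2103.06344 — 6 statements merged into one kernel-verified Lean document; each statement's English description precedes it below -/
import Mathlib

section
/- Let δt > 0 and let (r^n)_{n≥0}, (κ^n)_{n≥1}, (e^n)_{n≥1} be real sequences with e^n > 0 and κ^n ≥ 0 for all n ≥ 1, satisfying for every n ≥ 0 the scalar auxiliary variable update (r^{n+1} − r^n)/δt = −(r^{n+1}/e^{n+1})·κ^{n+1}. If r^0 ≥ 0, then for every n ≥ 0 one has r^{n+1} = r^n/(1 + δt·κ^{n+1}/e^{n+1}), r^n ≥ 0, the quantity ξ^{n+1} := r^{n+1}/e^{n+1} satisfies ξ^{n+1} ≥ 0, and r^{n+1} − r^n = −δt·ξ^{n+1}·κ^{n+1} ≤ 0; in particular the sequence (r^n) is nonincreasing and 0 ≤ r^n ≤ r^0 for all n. -/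
/-- Unconditional energy stability of the SAV update (Theorem 1, stability part):
the scalar auxiliary variable `r` stays nonnegative, satisfies the explicit
solution formula, decreases by `δt·ξ^{n+1}·κ^{n+1}`, and is nonincreasing with
`0 ≤ r^n ≤ r^0`. -/
theorem sav_unconditional_stability
    (δt : ℝ) (hδt : 0 < δt) (r κ e : ℕ → ℝ)
    (he : ∀ n, 1 ≤ n → 0 < e n) (hκ : ∀ n, 1 ≤ n → 0 ≤ κ n)
    (hupd : ∀ n : ℕ, (r (n + 1) - r n) / δt = -(r (n + 1) / e (n + 1)) * κ (n + 1))
    (hr0 : 0 ≤ r 0) :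
    (∀ n : ℕ, r (n + 1) = r n / (1 + δt * κ (n + 1) / e (n + 1))) ∧
    (∀ n : ℕ, 0 ≤ r n) ∧
    (∀ n : ℕ, 0 ≤ r (n + 1) / e (n + 1)) ∧
    (∀ n : ℕ, r (n + 1) - r n = -δt * (r (n + 1) / e (n + 1)) * κ (n + 1) ∧
      r (n + 1) - r n ≤ 0) ∧
    (∀ n : ℕ, r (n + 1) ≤ r n) ∧
    (∀ n : ℕ, 0 ≤ r n ∧ r n ≤ r 0) := by
  have hdiff (n : ℕ) : r (n + 1) - r n = -δt * (r (n + 1) / e (n + 1)) * κ (n + 1) := by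
    rw [(div_eq_iff hδt.ne').mp (hupd n)]
    ring
  have hden (n : ℕ) : 0 < 1 + δt * κ (n + 1) / e (n + 1) := by
    have := he (n + 1) n.succ_pos
    have := hκ (n + 1) n.succ_pos
    positivity
  have hsol (n : ℕ) : r (n + 1) = r n / (1 + δt * κ (n + 1) / e (n + 1)) := by
    rw [eq_div_iff (hden n).ne']
    linear_combination hdiff n
  have hr (n : ℕ) : 0 ≤ r n := by
    induction n with
    | zero => exact hr0
    | succ n ih => exact hsol n ▸ div_nonneg ih (hden n).le
  have hξ (n : ℕ) : 0 ≤ r (n + 1) / e (n + 1) :=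
    div_nonneg (hr _) (he _ n.succ_pos).le
  have hdec (n : ℕ) : r (n + 1) - r n ≤ 0 := by
    rw [hdiff]
    linarith [mul_nonneg (mul_nonneg hδt.le (hξ n)) (hκ _ n.succ_pos)]
  have hstep (n : ℕ) : r (n + 1) ≤ r n := sub_nonpos.mp (hdec n)
  exact ⟨hsol, hr, hξ, fun n => ⟨hdiff n, hdec n⟩, hstep,
    fun n => ⟨hr n, antitone_nat_of_succ_le hstep n.zero_le⟩⟩
end

section
/- Let H be a real inner product space, L : H → H a continuous linear operator with ⟨L v, v⟩ ≥ 0 for all v ∈ H, E₁ : H → ℝ with E₁(v) ≥ 1 for all v, and define the energy E(v) := (1/2)⟨L v, v⟩ + E₁(v) (so E(v) > 0). Fix an integer k ≥ 1, δt > 0 and M ≥ 0. Let ū : ℕ → H, κ : ℕ → ℝ with κ^n ≥ 0, and let r : ℕ → ℝ satisfy r^0 = M and r^{n+1}·(1 + δt·κ^{n+1}/E(ū^{n+1})) = r^n for all n ≥ 0. Define ξ^n := r^n/E(ū^n), η^n := 1 − (1 − ξ^n)^{k+1}, and u^n := η^n · ū^n for n ≥ 1. Then there exists a constant M_k > 0,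 depending only on k and M (and not on δt, ū, κ or n), such that ⟨L u^n, u^n⟩ ≤ M_k² for all n ≥ 1. -/
open scoped RealInnerProductSpace

/-- Dividing at each step by a factor `1 + c n ≥ 1` keeps
a sequence with nonnegative initial value between zero and that value. -/
lemma nonneg_and_le_of_mul_one_add_eq {r c : ℕ → ℝ} (hc : ∀ n, 0 ≤ c n) (h0 : 0 ≤ r 0)
    (h : ∀ n, r (n + 1) * (1 + c n) = r n) (n : ℕ) : 0 ≤ r n ∧ r n ≤ r 0 := by
  induction n with
  | zero => exact ⟨h0, le_rfl⟩
  | succ n ih =>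
    have hpos : 0 < 1 + c n := by linarith [hc n]
    have hnn : 0 ≤ r (n + 1) := nonneg_of_mul_nonneg_left (by rw [h n]; exact ih.1) hpos
    have := mul_nonneg hnn (hc n)
    exact ⟨hnn, by linarith [h n, ih.2]⟩

lemma abs_one_sub_one_sub_pow_le {x M : ℝ} (hx : 0 ≤ x) (hxM : x ≤ M) (m : ℕ) :
    |1 - (1 - x) ^ m| ≤ x * ∑ i ∈ Finset.range m, (1 + M) ^ i := by
  have hgeom : 1 - (1 - x) ^ m = x * ∑ i ∈ Finset.range m, (1 - x) ^ i := by
    rw [← mul_neg_geom_sum (1 - x) m, sub_sub_cancel]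
  have habs : |1 - x| ≤ 1 + M := abs_le.2 ⟨by linarith, by linarith⟩
  rw [hgeom, abs_mul, abs_of_nonneg hx]
  gcongr
  refine (Finset.abs_sum_le_sum_abs _ _).trans (Finset.sum_le_sum fun i _ => ?_)
  rw [abs_pow]
  gcongr

/-- Uniform bound part of Theorem 1: for the kth-order SAV scheme, the numerical
solution `u^n = η^n • ū^n` with `η^n = 1 - (1 - ξ^n)^{k+1}`, `ξ^n = r^n / E(ū^n)`,
is uniformly bounded in the seminorm induced by the principal linear operator `L`
of the energy `E(v) = (1/2)⟪L v, v⟫ + E₁(v)`, by a constant depending only on `k`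
and `M = r^0`. -/
theorem sav_uniform_bound (k : ℕ) (hk : 1 ≤ k) (M : ℝ) (hM : 0 ≤ M) :
    ∃ Mk : ℝ, 0 < Mk ∧
      ∀ (H : Type) (_ : NormedAddCommGroup H), ∀ (_ : InnerProductSpace ℝ H),
        ∀ (L : H →L[ℝ] H), (∀ v : H, 0 ≤ ⟪L v, v⟫) →
        ∀ (E₁ : H → ℝ), (∀ v : H, 1 ≤ E₁ v) →
        ∀ (δt : ℝ), 0 < δt →
        ∀ (ubar : ℕ → H) (κ : ℕ → ℝ), (∀ n, 0 ≤ κ n) →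
        ∀ (r : ℕ → ℝ), r 0 = M →
        (∀ n : ℕ, r (n + 1) *
            (1 + δt * κ (n + 1) /
              ((1 / 2) * ⟪L (ubar (n + 1)), ubar (n + 1)⟫ + E₁ (ubar (n + 1)))) = r n) →
        ∀ n : ℕ, 1 ≤ n →
          ⟪L ((1 - (1 - r n / ((1 / 2) * ⟪L (ubar n), ubar n⟫ + E₁ (ubar n))) ^ (k + 1))
                • ubar n),
            (1 - (1 - r n / ((1 / 2) * ⟪L (ubar n), ubar n⟫ + E₁ (ubar n))) ^ (k + 1))
                • ubar n⟫ ≤ Mk ^ 2 := by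
  set C : ℝ := ∑ i ∈ Finset.range (k + 1), (1 + M) ^ i with hC
  have hC0 : 0 ≤ C := Finset.sum_nonneg fun i _ => by positivity
  refine ⟨2 * (M * C) + 1, by positivity, ?_⟩
  intro H _ _ L hL E₁ hE₁ δt hδt ubar κ hκ r hr0 hr n _
  have hE : ∀ v : H, 1 ≤ (1 / 2) * ⟪L v, v⟫ + E₁ v := fun v => by linarith [hL v, hE₁ v]
  obtain ⟨hrn, hrM⟩ := nonneg_and_le_of_mul_one_add_eq
    (fun m => div_nonneg (mul_nonneg hδt.le (hκ (m + 1)))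
      (zero_le_one.trans (hE (ubar (m + 1))))) (hr0 ▸ hM) hr n
  rw [hr0] at hrM
  have ha := hL (ubar n)
  have hE1 := hE (ubar n)
  have haE : ⟪L (ubar n), ubar n⟫ ≤ 2 * ((1 / 2) * ⟪L (ubar n), ubar n⟫ + E₁ (ubar n)) := by
    linarith [hE₁ (ubar n)]
  rw [map_smul, real_inner_smul_left, real_inner_smul_right]
  generalize (1 / 2) * ⟪L (ubar n), ubar n⟫ + E₁ (ubar n) = e at hE1 haE ⊢
  generalize ⟪L (ubar n), ubar n⟫ = a at ha haE ⊢
  have he : 0 < e := by linarith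
  have hξ : 0 ≤ r n / e := div_nonneg hrn he.le
  have hη := abs_one_sub_one_sub_pow_le hξ ((div_le_self hrn hE1).trans hrM) (k + 1)
  rw [← hC] at hη
  generalize 1 - (1 - r n / e) ^ (k + 1) = η at hη ⊢
  have hηe : |η| * e ≤ M * C := by
    calc |η| * e ≤ r n / e * C * e := by gcongr
      _ = r n * C := by field_simp
      _ ≤ M * C := by gcongr
  have hae : a ≤ 2 * e ^ 2 := by nlinarith
  calc η * (η * a) = |η| ^ 2 * a := by rw [sq_abs]; ring
    _ ≤ |η| ^ 2 * (2 * e ^ 2) := by gcongr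
    _ = 2 * (|η| * e) ^ 2 := by ring
    _ ≤ 2 * (M * C) ^ 2 := by gcongr
    _ ≤ (2 * (M * C) + 1) ^ 2 := by nlinarith [mul_nonneg hM hC0]
end

section
/- There exist a real number τ with 0 ≤ τ < 1, a symmetric positive definite real 3×3 matrix G = (g_{ij})_{1≤i,j≤3}, and real numbers δ₀, δ₁, δ₂, δ₃, such that for every real inner product space H and all vectors v₀, v₁, v₂, v₃ ∈ H: ⟨(11/6)v₃ − 3v₂ + (3/2)v₁ − (1/3)v₀, v₃ − τ·v₂⟩ = Σ_{i,j=1}^{3} g_{ij}·⟨v_i, v_j⟩ − Σ_{i,j=1}^{3} g_{ij}·⟨v_{i−1}, v_{j−1}⟩ + ‖δ₀·v₀ + δ₁·v₁ + δ₂·v₂ + δ₃·v₃‖². -/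
open scoped RealInnerProductSpace

open scoped Matrix in
/-- Sylvester's criterion for a real symmetric `3 × 3` matrix. -/
lemma Matrix.posDef_fin_three {a b c d e f : ℝ} (ha : 0 < a) (hm : 0 < a * c - b ^ 2)
    (hdet : 0 < a * c * f + 2 * b * d * e - a * e ^ 2 - c * d ^ 2 - f * b ^ 2) :
    (!![a, b, d; b, c, e; d, e, f] : Matrix (Fin 3) (Fin 3) ℝ).PosDef := by
  refine Matrix.PosDef.of_dotProduct_mulVec_pos ?_ fun x hx => ?_
  · ext i j
    fin_cases i <;> fin_cases j <;> rfl
  · set m := a * c - b ^ 2 with hm_def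
    set D := a * c * f + 2 * b * d * e - a * e ^ 2 - c * d ^ 2 - f * b ^ 2 with hD
    have key : a * m * (star x ⬝ᵥ (!![a, b, d; b, c, e; d, e, f] *ᵥ x)) =
        m * (a * x 0 + b * x 1 + d * x 2) ^ 2 + (m * x 1 + (a * e - b * d) * x 2) ^ 2 +
          a * D * x 2 ^ 2 := by
      simp [Matrix.mulVec, dotProduct, Fin.sum_univ_three, hm_def, hD]
      ring
    refine pos_of_mul_pos_right (a := a * m) ?_ (by positivity)
    rw [key]
    by_contra! hle
    have h₁ : 0 ≤ m * (a * x 0 + b * x 1 + d * x 2) ^ 2 := by positivity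
    have h₂ : 0 ≤ (m * x 1 + (a * e - b * d) * x 2) ^ 2 := by positivity
    have h₃ : 0 ≤ a * D * x 2 ^ 2 := by positivity
    have hz₂ : x 2 = 0 := by
      have h : a * D * x 2 ^ 2 = 0 := by linarith
      simpa [ha.ne', hdet.ne'] using h
    have hz₁ : x 1 = 0 := by
      have h : (m * x 1 + (a * e - b * d) * x 2) ^ 2 = 0 := by linarith
      simpa [hz₂, hm.ne'] using h
    have hz₀ : x 0 = 0 := by
      have h : m * (a * x 0 + b * x 1 + d * x 2) ^ 2 = 0 := by linarith
      simpa [hz₁, hz₂, hm.ne', ha.ne'] using h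
    apply hx
    ext i
    fin_cases i <;> assumption

/-- Nevanlinna–Odeh G-stability for BDF3 (Lemma 1, k = 3): there exist
`0 ≤ τ < 1`, a symmetric positive definite 3×3 matrix `G` and reals
`δ₀,…,δ₃` such that the pairing of the BDF3 difference with `v₃ − τ v₂`
telescopes as a quadratic form plus a nonnegative remainder. -/
theorem bdf3_gstability :
    ∃ (τ : ℝ) (G : Matrix (Fin 3) (Fin 3) ℝ) (d : Fin 4 → ℝ),
      0 ≤ τ ∧ τ < 1 ∧ G.IsSymm ∧ G.PosDef ∧
      ∀ (H : Type) (_ : NormedAddCommGroup H), ∀ (_ : InnerProductSpace ℝ H),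
        ∀ v : Fin 4 → H,
        ⟪(11 / 6 : ℝ) • v 3 - (3 : ℝ) • v 2 + (3 / 2 : ℝ) • v 1 - (1 / 3 : ℝ) • v 0,
            v 3 - τ • v 2⟫ =
          (∑ i : Fin 3, ∑ j : Fin 3, G i j * ⟪v i.succ, v j.succ⟫) -
            (∑ i : Fin 3, ∑ j : Fin 3, G i j * ⟪v i.castSucc, v j.castSucc⟫) +
            ‖∑ i : Fin 4, d i • v i‖ ^ 2 := by
  obtain ⟨w, hw, hlo, hhi⟩ : ∃ w : ℝ, w ^ 2 = 15 ∧ 3.872983 < w ∧ w < 3.872984 :=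
    ⟨√15, Real.sq_sqrt (by norm_num), Real.lt_sqrt_of_sq_lt (by norm_num),
      (Real.sqrt_lt' (by norm_num)).2 (by norm_num)⟩
  obtain ⟨k, hk⟩ : ∃ k : ℝ, k ^ 2 = 1 / 90 := ⟨√(1 / 90), Real.sq_sqrt (by norm_num)⟩
  refine ⟨437 / 30 - 56 / 15 * w,
    !![5 / 18, -37 / 18 + 7 / 18 * w, -29 / 60 + 7 / 30 * w;
      -37 / 18 + 7 / 18 * w, 2129 / 90 - 259 / 45 * w, -4927 / 360 + 287 / 90 * w;
      -29 / 60 + 7 / 30 * w, -4927 / 360 + 287 / 90 * w, 26 / 15],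
    ![-5 * k, (37 - 7 * w) * k, (-35 + 7 * w) * k, 3 * k],
    by linarith, by linarith, ?_, Matrix.posDef_fin_three (by norm_num) ?_ ?_, ?_⟩
  · ext i j
    fin_cases i <;> fin_cases j <;> rfl
  · nlinarith
  · have hw₃ : w ^ 3 = 15 * w := by rw [pow_succ, hw]
    ring_nf
    rw [hw₃, hw]
    linarith
  · intro H _ _ v
    rw [← real_inner_self_eq_norm_sq]
    simp only [Fin.sum_univ_three, Fin.sum_univ_four, inner_add_left, inner_add_right,
      inner_sub_left, inner_sub_right, real_inner_smul_left, real_inner_smul_right]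
    simp [-inner_self_eq_norm_sq_to_K]
    rw [real_inner_comm (v 0) (v 1), real_inner_comm (v 0) (v 2), real_inner_comm (v 0) (v 3),
      real_inner_comm (v 1) (v 2), real_inner_comm (v 1) (v 3), real_inner_comm (v 2) (v 3)]
    linear_combination
      -(25 * ⟪v 0, v 0⟫ + (37 - 7 * w) ^ 2 * ⟪v 1, v 1⟫ + (-35 + 7 * w) ^ 2 * ⟪v 2, v 2⟫ +
        9 * ⟪v 3, v 3⟫ - 10 * (37 - 7 * w) * ⟪v 0, v 1⟫ - 10 * (-35 + 7 * w) * ⟪v 0, v 2⟫ -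
        30 * ⟪v 0, v 3⟫ + 2 * (37 - 7 * w) * (-35 + 7 * w) * ⟪v 1, v 2⟫ +
        6 * (37 - 7 * w) * ⟪v 1, v 3⟫ + 6 * (-35 + 7 * w) * ⟪v 2, v 3⟫) * hk -
      49 / 90 * (⟪v 1, v 1⟫ - 2 * ⟪v 1, v 2⟫ + ⟪v 2, v 2⟫) * hw
end

section
/- There exist a real number τ with 0 ≤ τ < 1, a symmetric positive definite real 4×4 matrix G = (g_{ij})_{1≤i,j≤4}, and real numbers δ₀, δ₁, δ₂, δ₃, δ₄, such that for every real inner product space H and all vectors v₀, v₁, v₂, v₃, v₄ ∈ H: ⟨(25/12)v₄ − 4v₃ + 3v₂ − (4/3)v₁ + (1/4)v₀, v₄ − τ·v₃⟩ = Σ_{i,j=1}^{4} g_{ij}·⟨v_i, v_j⟩ − Σ_{i,j=1}^{4} g_{ij}·⟨v_{i−1}, v_{j−1}⟩ + ‖δ₀·v₀ + δ₁·v₁ + δ₂·v₂ + δ₃·v₃ + δ₄·v₄‖². -/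
open scoped RealInnerProductSpace

/-- A real spectral factor of the symbol of the BDF4 pairing for `τ = 2 / 3`, given by its
autocorrelation coefficients, together with its numerical location. -/
lemma exists_bdf4_spectral_factor :
    ∃ d : Fin 5 → ℝ,
      d 0 ^ 2 + d 1 ^ 2 + d 2 ^ 2 + d 3 ^ 2 + d 4 ^ 2 = 19 / 4 ∧
      d 0 * d 1 + d 1 * d 2 + d 2 * d 3 + d 3 * d 4 = -133 / 36 ∧
      d 0 * d 2 + d 1 * d 3 + d 2 * d 4 = 35 / 18 ∧
      d 0 * d 3 + d 1 * d 4 = -3 / 4 ∧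
      d 0 * d 4 = 1 / 8 ∧
      |d 0 - (-1.04361338)| ≤ 1 / 100000 ∧
      |d 1 - (1.56968149)| ≤ 1 / 100000 ∧
      |d 2 - (-0.94479557)| ≤ 1 / 100000 ∧
      |d 3 - (0.53850362)| ≤ 1 / 100000 ∧
      |d 4 - (-0.11977616)| ≤ 1 / 100000 := by
  set s := √(15 : ℝ)
  have hs2 : s ^ 2 = 15 := Real.sq_sqrt (by norm_num)
  have s_lo : 3.8729833462 ≤ s := Real.le_sqrt_of_sq_le (by norm_num)
  have s_hi : s ≤ 3.8729833463 := Real.sqrt_le_iff.2 (by norm_num)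
  set r := √((s - 2) / 6)
  have hr2 : r ^ 2 = (s - 2) / 6 := Real.sq_sqrt (by linarith)
  have r_lo : 0.558716288 ≤ r := Real.le_sqrt_of_sq_le (by norm_num; linarith)
  have r_hi : r ≤ 0.558716289 := Real.sqrt_le_iff.2 ⟨by norm_num, by norm_num; linarith⟩
  set k := √(3 / 2 : ℝ)
  have hk2 : k ^ 2 = 3 / 2 := Real.sq_sqrt (by norm_num)
  have k_lo : 1.224744871 ≤ k := Real.le_sqrt_of_sq_le (by norm_num)
  have k_hi : k ≤ 1.224744872 := Real.sqrt_le_iff.2 (by norm_num)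
  clear_value s r k
  obtain ⟨x, hx⟩ : ∃ x, x = ((s + 3) / 6 + r) / 2 := ⟨_, rfl⟩
  obtain ⟨y, hy⟩ : ∃ y, y = -(s - 3) / 6 := ⟨_, rfl⟩
  obtain ⟨w, hw⟩ : ∃ w, w = ((s + 3) / 6 - r) / 2 := ⟨_, rfl⟩
  have hxw : x * w = 1 / 4 := by subst hx hw; linear_combination hs2 / 144 - hr2 / 4
  have hxwy : (x + w) * y = -1 / 6 := by subst hx hy hw; linear_combination -hs2 / 36
  have hsq : x ^ 2 + y ^ 2 + w ^ 2 = 5 / 6 := by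
    subst hx hy hw; linear_combination hs2 * (1 / 72 + 1 / 36) + hr2 / 2
  have scale {e a : ℝ} (ha : |a| ≤ 2) (he : |e - a| ≤ 1 / 1000000) :
      |k * e - 1.224744871 * a| ≤ 2 / 1000000 := by
    rw [abs_le] at *
    constructor <;> nlinarith
  refine ⟨![k * -x, k * (4 / 3 * x - y), k * (-x / 3 + 4 / 3 * y - w), k * (-y / 3 + 4 / 3 * w),
    k * (-w / 3)], ?_⟩
  have b0 := scale (e := -x) (a := -0.8521067564) (by norm_num [abs_le])
    (by rw [abs_le]; constructor <;> linarith)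
  have b1 := scale (e := 4 / 3 * x - y) (a := 1.2816395663) (by norm_num [abs_le])
    (by rw [abs_le]; constructor <;> linarith)
  have b2 := scale (e := -x / 3 + 4 / 3 * y - w) (a := -0.7714223526) (by norm_num [abs_le])
    (by rw [abs_le]; constructor <;> linarith)
  have b3 := scale (e := -y / 3 + 4 / 3 * w) (a := 0.4396863654) (by norm_num [abs_le])
    (by rw [abs_le]; constructor <;> linarith)
  have b4 := scale (e := -w / 3) (a := -0.0977968226) (by norm_num [abs_le])
    (by rw [abs_le]; constructor <;> linarith)
  simp only [Matrix.cons_val]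
  rw [abs_le] at b0 b1 b2 b3 b4
  refine ⟨?_, ?_, ?_, ?_, ?_, ?_, ?_, ?_, ?_, ?_⟩
  · linear_combination ((-x) ^ 2 + (4 / 3 * x - y) ^ 2 + (-x / 3 + 4 / 3 * y - w) ^ 2 +
      (-y / 3 + 4 / 3 * w) ^ 2 + (-w / 3) ^ 2) * hk2 + 13 / 3 * hsq - 16 / 3 * hxwy + hxw
  · linear_combination ((-x) * (4 / 3 * x - y) + (4 / 3 * x - y) * (-x / 3 + 4 / 3 * y - w) +
      (-x / 3 + 4 / 3 * y - w) * (-y / 3 + 4 / 3 * w) + (-y / 3 + 4 / 3 * w) * (-w / 3)) * hk2 -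
      8 / 3 * hsq + 29 / 6 * hxwy - 8 / 3 * hxw
  · linear_combination ((-x) * (-x / 3 + 4 / 3 * y - w) + (4 / 3 * x - y) * (-y / 3 + 4 / 3 * w) +
      (-x / 3 + 4 / 3 * y - w) * (-w / 3)) * hk2 + hsq / 2 - 8 / 3 * hxwy + 13 / 3 * hxw
  · linear_combination ((-x) * (-y / 3 + 4 / 3 * w) + (4 / 3 * x - y) * (-w / 3)) * hk2 +
      hxwy / 2 - 8 / 3 * hxw
  · linear_combination (x * w / 3) * hk2 + hxw / 2
  all_goals rw [abs_le]; constructor <;> linarith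

lemma abs_mul_sub_mul_le {a b a₀ b₀ : ℝ} (ha : |a - a₀| ≤ 1 / 100000)
    (hb : |b - b₀| ≤ 1 / 100000) (ha₀ : |a₀| ≤ 2) (hb₀ : |b₀| ≤ 2) :
    |a * b - a₀ * b₀| ≤ 1 / 20000 := by
  have h : a * b - a₀ * b₀ = (a - a₀) * (b - b₀) + a₀ * (b - b₀) + (a - a₀) * b₀ := by ring
  rw [h]
  refine (abs_add_three _ _ _).trans ?_
  simp only [abs_mul]
  have h1 := mul_le_mul ha hb (abs_nonneg _) (by norm_num)
  have h2 := mul_le_mul ha₀ hb (abs_nonneg _) (by norm_num)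
  have h3 := mul_le_mul ha hb₀ (abs_nonneg _) (by norm_num)
  linarith

/-- The symmetric matrix obtained from a spectral factor `d` of the BDF4 pairing. -/
noncomputable def bdf4Matrix (d : Fin 5 → ℝ) : Matrix (Fin 4) (Fin 4) ℝ :=
  !![d 0 ^ 2, d 0 * d 1, d 0 * d 2, d 0 * d 3 + 1 / 12;
      d 0 * d 1, d 1 ^ 2 + d 0 ^ 2, d 1 * d 2 + d 0 * d 1, d 1 * d 3 + d 0 * d 2 - 4 / 9;
      d 0 * d 2, d 1 * d 2 + d 0 * d 1, d 2 ^ 2 + d 1 ^ 2 + d 0 ^ 2, d 2 * d 3 + d 1 * d 2 + d 0 * d 1 + 1;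
      d 0 * d 3 + 1 / 12, d 1 * d 3 + d 0 * d 2 - 4 / 9, d 2 * d 3 + d 1 * d 2 + d 0 * d 1 + 1, d 3 ^ 2 + d 2 ^ 2 + d 1 ^ 2 + d 0 ^ 2 - 8 / 3]

lemma neg_le_mul_mul_of_abs_sub_le {g g₀ ε : ℝ} (h : |g - g₀| ≤ ε) (a b : ℝ) :
    g₀ * (a * b) - ε * ((a ^ 2 + b ^ 2) / 2) ≤ g * (a * b) := by
  have h1 : |(g - g₀) * (a * b)| ≤ ε * ((a ^ 2 + b ^ 2) / 2) := by
    rw [abs_mul]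
    refine mul_le_mul h ?_ (abs_nonneg _) ((abs_nonneg _).trans h)
    rw [abs_le]
    constructor <;> nlinarith [sq_nonneg (a + b), sq_nonneg (a - b)]
  linarith [(abs_le.1 h1).1]

lemma posDef_of_near_bdf4 {G : Matrix (Fin 4) (Fin 4) ℝ} (hG : G.IsSymm)
    (h00 : |G 0 0 - (1089 / 1000)| ≤ 1 / 1000)
    (h01 : |G 0 1 - (-1638 / 1000)| ≤ 1 / 1000)
    (h02 : |G 0 2 - (986 / 1000)| ≤ 1 / 1000)
    (h03 : |G 0 3 - (-479 / 1000)| ≤ 1 / 1000)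
    (h11 : |G 1 1 - (3553 / 1000)| ≤ 1 / 1000)
    (h12 : |G 1 2 - (-3121 / 1000)| ≤ 1 / 1000)
    (h13 : |G 1 3 - (1387 / 1000)| ≤ 1 / 1000)
    (h22 : |G 2 2 - (4446 / 1000)| ≤ 1 / 1000)
    (h23 : |G 2 3 - (-2630 / 1000)| ≤ 1 / 1000)
    (h33 : |G 3 3 - (2069 / 1000)| ≤ 1 / 1000) :
    G.PosDef := by
  refine .of_dotProduct_mulVec_pos (by simpa [Matrix.IsHermitian] using hG.eq) fun x hx ↦ ?_
  have hpos : 0 < x 0 ^ 2 + x 1 ^ 2 + x 2 ^ 2 + x 3 ^ 2 := by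
    have h := Matrix.dotProduct_star_self_pos_iff.2 hx
    simpa [dotProduct, Fin.sum_univ_four, ← sq] using h
  have hsum : star x ⬝ᵥ G.mulVec x =
      G 0 0 * x 0 ^ 2 + 2 * (G 0 1 * (x 0 * x 1)) +
      2 * (G 0 2 * (x 0 * x 2)) + 2 * (G 0 3 * (x 0 * x 3)) +
      G 1 1 * x 1 ^ 2 +
      2 * (G 1 2 * (x 1 * x 2)) +
      2 * (G 1 3 * (x 1 * x 3)) +
      G 2 2 * x 2 ^ 2 + 2 * (G 2 3 * (x 2 * x 3)) + G 3 3 * x 3 ^ 2 := by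
    simp only [dotProduct, Matrix.mulVec, Fin.sum_univ_four, star_trivial, hG.apply 0 1,
      hG.apply 0 2, hG.apply 0 3, hG.apply 1 2, hG.apply 1 3, hG.apply 2 3]
    ring
  rw [hsum]
  have b00 := neg_le_mul_mul_of_abs_sub_le h00 (x 0) (x 0)
  have b01 := neg_le_mul_mul_of_abs_sub_le h01 (x 0) (x 1)
  have b02 := neg_le_mul_mul_of_abs_sub_le h02 (x 0) (x 2)
  have b03 := neg_le_mul_mul_of_abs_sub_le h03 (x 0) (x 3)
  have b11 := neg_le_mul_mul_of_abs_sub_le h11 (x 1) (x 1)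
  have b12 := neg_le_mul_mul_of_abs_sub_le h12 (x 1) (x 2)
  have b13 := neg_le_mul_mul_of_abs_sub_le h13 (x 1) (x 3)
  have b22 := neg_le_mul_mul_of_abs_sub_le h22 (x 2) (x 2)
  have b23 := neg_le_mul_mul_of_abs_sub_le h23 (x 2) (x 3)
  have b33 := neg_le_mul_mul_of_abs_sub_le h33 (x 3) (x 3)
  linarith [sq_nonneg (x 3 - 1.2804 * x 2 + 0.6753 * x 1 - 0.2332 * x 0),
    sq_nonneg (x 2 - 1.2648 * x 1 + 0.3504 * x 0),
    sq_nonneg (x 1 - 0.9366 * x 0),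
    sq_nonneg (x 0 + x 1),
    sq_nonneg (x 0 - x 1),
    sq_nonneg (x 0 + x 2),
    sq_nonneg (x 0 - x 2),
    sq_nonneg (x 0 + x 3),
    sq_nonneg (x 0 - x 3),
    sq_nonneg (x 1 + x 2),
    sq_nonneg (x 1 - x 2),
    sq_nonneg (x 1 + x 3),
    sq_nonneg (x 1 - x 3),
    sq_nonneg (x 2 + x 3),
    sq_nonneg (x 2 - x 3)]

lemma bdf4Matrix_isSymm (d : Fin 5 → ℝ) : (bdf4Matrix d).IsSymm := by
  ext i j
  fin_cases i <;> fin_cases j <;> rfl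

/-- Nevanlinna–Odeh G-stability for BDF4 (Lemma 1, k = 4): there exist
`0 ≤ τ < 1`, a symmetric positive definite 4×4 matrix `G` and reals
`δ₀,…,δ₄` such that the pairing of the BDF4 difference with `v₄ − τ v₃`
telescopes as a quadratic form plus a nonnegative remainder. -/
theorem bdf4_gstability :
    ∃ (τ : ℝ) (G : Matrix (Fin 4) (Fin 4) ℝ) (d : Fin 5 → ℝ),
      0 ≤ τ ∧ τ < 1 ∧ G.IsSymm ∧ G.PosDef ∧
      ∀ (H : Type) (_ : NormedAddCommGroup H), ∀ (_ : InnerProductSpace ℝ H),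
        ∀ v : Fin 5 → H,
        ⟪(25 / 12 : ℝ) • v 4 - (4 : ℝ) • v 3 + (3 : ℝ) • v 2 - (4 / 3 : ℝ) • v 1 +
            (1 / 4 : ℝ) • v 0, v 4 - τ • v 3⟫ =
          (∑ i : Fin 4, ∑ j : Fin 4, G i j * ⟪v i.succ, v j.succ⟫) -
            (∑ i : Fin 4, ∑ j : Fin 4, G i j * ⟪v i.castSucc, v j.castSucc⟫) +
            ‖∑ i : Fin 5, d i • v i‖ ^ 2 := by
  obtain ⟨d, c0, c1, c2, c3, c4, b0, b1, b2, b3, b4⟩ := exists_bdf4_spectral_factor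
  refine ⟨2 / 3, bdf4Matrix d, d, by norm_num, by norm_num, bdf4Matrix_isSymm d, ?_, ?_⟩
  · have p00 := abs_le.1 (abs_mul_sub_mul_le b0 b0 (by norm_num [abs_le]) (by norm_num [abs_le]))
    have p01 := abs_le.1 (abs_mul_sub_mul_le b0 b1 (by norm_num [abs_le]) (by norm_num [abs_le]))
    have p02 := abs_le.1 (abs_mul_sub_mul_le b0 b2 (by norm_num [abs_le]) (by norm_num [abs_le]))
    have p03 := abs_le.1 (abs_mul_sub_mul_le b0 b3 (by norm_num [abs_le]) (by norm_num [abs_le]))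
    have p11 := abs_le.1 (abs_mul_sub_mul_le b1 b1 (by norm_num [abs_le]) (by norm_num [abs_le]))
    have p12 := abs_le.1 (abs_mul_sub_mul_le b1 b2 (by norm_num [abs_le]) (by norm_num [abs_le]))
    have p13 := abs_le.1 (abs_mul_sub_mul_le b1 b3 (by norm_num [abs_le]) (by norm_num [abs_le]))
    have p22 := abs_le.1 (abs_mul_sub_mul_le b2 b2 (by norm_num [abs_le]) (by norm_num [abs_le]))
    have p23 := abs_le.1 (abs_mul_sub_mul_le b2 b3 (by norm_num [abs_le]) (by norm_num [abs_le]))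
    have p33 := abs_le.1 (abs_mul_sub_mul_le b3 b3 (by norm_num [abs_le]) (by norm_num [abs_le]))
    apply posDef_of_near_bdf4 (bdf4Matrix_isSymm d) <;>
      simp only [bdf4Matrix, Matrix.of_apply, Matrix.cons_val, Matrix.cons_val'] <;>
      rw [abs_le] <;> constructor <;> linarith
  · intro H _ _ v
    rw [← real_inner_self_eq_norm_sq]
    have s0 : (0 : Fin 4).succ = (1 : Fin 5) := rfl
    have s1 : (1 : Fin 4).succ = (2 : Fin 5) := rfl
    have s2 : (2 : Fin 4).succ = (3 : Fin 5) := rfl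
    have s3 : (3 : Fin 4).succ = (4 : Fin 5) := rfl
    have t0 : (0 : Fin 4).castSucc = (0 : Fin 5) := rfl
    have t1 : (1 : Fin 4).castSucc = (1 : Fin 5) := rfl
    have t2 : (2 : Fin 4).castSucc = (2 : Fin 5) := rfl
    have t3 : (3 : Fin 4).castSucc = (3 : Fin 5) := rfl
    simp only [Fin.sum_univ_four, Fin.sum_univ_five, bdf4Matrix, Matrix.of_apply, Matrix.cons_val,
      s0, s1, s2, s3, t0, t1, t2, t3, inner_add_left, inner_add_right, inner_sub_left,
      inner_sub_right, real_inner_smul_left, real_inner_smul_right,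
      real_inner_comm (v 0) (v 1), real_inner_comm (v 0) (v 2), real_inner_comm (v 0) (v 3),
      real_inner_comm (v 0) (v 4), real_inner_comm (v 1) (v 2), real_inner_comm (v 1) (v 3),
      real_inner_comm (v 1) (v 4), real_inner_comm (v 2) (v 3), real_inner_comm (v 2) (v 4),
      real_inner_comm (v 3) (v 4)]
    linear_combination -⟪v 4, v 4⟫ * c0 - 2 * ⟪v 3, v 4⟫ * c1 - 2 * ⟪v 2, v 4⟫ * c2 -
      2 * ⟪v 1, v 4⟫ * c3 - 2 * ⟪v 0, v 4⟫ * c4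
end

section
/- There exist a real number τ with 0 ≤ τ < 1, a symmetric positive definite real 5×5 matrix G = (g_{ij})_{1≤i,j≤5}, and real numbers δ₀, …, δ₅, such that for every real inner product space H and all vectors v₀, v₁, v₂, v₃, v₄, v₅ ∈ H: ⟨(137/60)v₅ − 5v₄ + 5v₃ − (10/3)v₂ + (5/4)v₁ − (1/5)v₀, v₅ − τ·v₄⟩ = Σ_{i,j=1}^{5} g_{ij}·⟨v_i, v_j⟩ − Σ_{i,j=1}^{5} g_{ij}·⟨v_{i−1}, v_{j−1}⟩ + ‖Σ_{i=0}^{5} δ_i·v_i‖². -/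
open scoped RealInnerProductSpace
open scoped Matrix

/-- Coefficients of the BDF5 difference. -/
noncomputable def bdf5Coeff : Fin 6 → ℝ := ![-1 / 5, 5 / 4, -10 / 3, 5, -5, 137 / 60]

/-- Symmetrized coefficients of `⟪∑ aᵢ vᵢ, v₅ - τ v₄⟫ - ‖∑ dᵢ vᵢ‖²` for the BDF5 coefficients `a`. -/
noncomputable def bdf5Defect (τ : ℝ) (d : Fin 6 → ℝ) (i j : Fin 6) : ℝ :=
  let m : Fin 6 → ℝ := ![0, 0, 0, 0, -τ, 1]
  (bdf5Coeff i * m j + bdf5Coeff j * m i) / 2 - d i * d j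

/-- The G-matrix, obtained by summing the defect along diagonals. -/
noncomputable def bdf5G (τ : ℝ) (d : Fin 6 → ℝ) : Matrix (Fin 5) (Fin 5) ℝ :=
  Matrix.of fun i j => -∑ k : Fin 5, if k ≤ i ∧ k ≤ j then
    bdf5Defect τ d (i - k).castSucc (j - k).castSucc else 0

/-- The autocorrelations of `d` are those prescribed by BDF5 with multiplier `τ`. -/
structure IsBDF5SpectralFactor (τ : ℝ) (d : Fin 6 → ℝ) : Prop where
  lag_zero : d 0 ^ 2 + d 1 ^ 2 + d 2 ^ 2 + d 3 ^ 2 + d 4 ^ 2 + d 5 ^ 2 = 137 / 60 + 5 * τ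
  lag_one : 2 * (d 0 * d 1 + d 1 * d 2 + d 2 * d 3 + d 3 * d 4 + d 4 * d 5) =
    -5 - (437 / 60) * τ
  lag_two : 2 * (d 0 * d 2 + d 1 * d 3 + d 2 * d 4 + d 3 * d 5) = 5 + (10 / 3) * τ
  lag_three : 2 * (d 0 * d 3 + d 1 * d 4 + d 2 * d 5) = -10 / 3 - (5 / 4) * τ
  lag_four : 2 * (d 0 * d 4 + d 1 * d 5) = 5 / 4 + (1 / 5) * τ
  lag_five : 2 * (d 0 * d 5) = -1 / 5

theorem bdf5G_isSymm (τ : ℝ) (d : Fin 6 → ℝ) : (bdf5G τ d).IsSymm := by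
  ext i j
  simp only [Matrix.transpose_apply, bdf5G, Matrix.of_apply, bdf5Defect]
  congr 1
  refine Finset.sum_congr rfl fun k _ => ?_
  simp only [and_comm (a := k ≤ j)]
  split_ifs <;> ring

theorem IsBDF5SpectralFactor.inner_eq {τ : ℝ} {d : Fin 6 → ℝ} (h : IsBDF5SpectralFactor τ d)
    {H : Type} [NormedAddCommGroup H] [InnerProductSpace ℝ H] (v : Fin 6 → H) :
    ⟪(137 / 60 : ℝ) • v 5 - (5 : ℝ) • v 4 + (5 : ℝ) • v 3 - (10 / 3 : ℝ) • v 2 +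
        (5 / 4 : ℝ) • v 1 - (1 / 5 : ℝ) • v 0, v 5 - τ • v 4⟫ =
      (∑ i : Fin 5, ∑ j : Fin 5, bdf5G τ d i j * ⟪v i.succ, v j.succ⟫) -
        (∑ i : Fin 5, ∑ j : Fin 5, bdf5G τ d i j * ⟪v i.castSucc, v j.castSucc⟫) +
        ‖∑ i : Fin 6, d i • v i‖ ^ 2 := by
  obtain ⟨h0, h1, h2, h3, h4, h5⟩ := h
  rw [← real_inner_self_eq_norm_sq]
  simp only [Fin.sum_univ_succ, Fin.sum_univ_zero, inner_add_left, inner_add_right, inner_sub_left,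
    inner_sub_right, real_inner_smul_left, real_inner_smul_right, bdf5G, bdf5Defect, bdf5Coeff,
    Matrix.of_apply]
  simp
  simp only [real_inner_comm (v 0) (v 1), real_inner_comm (v 0) (v 2), real_inner_comm (v 0) (v 3), real_inner_comm (v 0) (v 4), real_inner_comm (v 0) (v 5), real_inner_comm (v 1) (v 2), real_inner_comm (v 1) (v 3), real_inner_comm (v 1) (v 4), real_inner_comm (v 1) (v 5), real_inner_comm (v 2) (v 3), real_inner_comm (v 2) (v 4), real_inner_comm (v 2) (v 5), real_inner_comm (v 3) (v 4), real_inner_comm (v 3) (v 5), real_inner_comm (v 4) (v 5)]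
  linear_combination -‖v 5‖ ^ 2 * h0 - ⟪v 4, v 5⟫ * h1 - ⟪v 3, v 5⟫ * h2 - ⟪v 2, v 5⟫ * h3 -
    ⟪v 1, v 5⟫ * h4 - ⟪v 0, v 5⟫ * h5

/-- Along `v₅ = τ v₄` the quadratic form of `bdf5G` drops by the square of the remainder. -/
theorem IsBDF5SpectralFactor.quadForm_eq {τ : ℝ} {d : Fin 6 → ℝ} (h : IsBDF5SpectralFactor τ d)
    (a b c e f : ℝ) :
    ![a, b, c, e, f] ⬝ᵥ bdf5G τ d *ᵥ ![a, b, c, e, f] =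
      ![b, c, e, f, τ * f] ⬝ᵥ bdf5G τ d *ᵥ ![b, c, e, f, τ * f] +
        (d 0 * a + d 1 * b + d 2 * c + d 3 * e + d 4 * f + d 5 * (τ * f)) ^ 2 := by
  have key := h.inner_eq (H := ℝ) ![a, b, c, e, f, τ * f]
  rw [← real_inner_self_eq_norm_sq] at key
  simp [Fin.sum_univ_succ] at key
  simp [Matrix.mulVec, dotProduct, Fin.sum_univ_succ]
  linear_combination key

theorem bdf5_eval_neg {τ : ℝ} (hτ : 1 / 2 < τ) (hτ' : τ < 1) :
    137 / 60 * τ ^ 5 - 5 * τ ^ 4 + 5 * τ ^ 3 - 10 / 3 * τ ^ 2 + 5 / 4 * τ - 1 / 5 < 0 := by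
  have hs : 0 < 1 - τ := by linarith
  have h1 : 0 < τ ^ 3 * (1 - τ) * (3 * τ - 1) := by
    have : 0 < 3 * τ - 1 := by linarith
    positivity
  have h2 : 0 < τ * (1 - τ) ^ 3 * (7 * τ - 3) := by
    have : 0 < 7 * τ - 3 := by linarith
    positivity
  have h3 : 0 < (1 - τ) ^ 5 := by positivity
  linarith

theorem eq_zero_of_sum_sq_nonpos {p q r s : ℝ} (h : s ^ 2 + r ^ 2 + q ^ 2 + p ^ 2 ≤ 0) :
    p = 0 ∧ q = 0 ∧ r = 0 ∧ s = 0 := by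
  refine ⟨?_, ?_, ?_, ?_⟩ <;> refine pow_eq_zero_iff two_ne_zero |>.mp ?_ <;>
    linarith [sq_nonneg p, sq_nonneg q, sq_nonneg r, sq_nonneg s]

theorem IsBDF5SpectralFactor.posDef {τ : ℝ} {d : Fin 6 → ℝ} (h : IsBDF5SpectralFactor τ d)
    (hτ : 1 / 2 < τ) (hτ' : τ < 1) : (bdf5G τ d).PosDef := by
  have hd0 : d 0 ≠ 0 := by
    intro h0
    have := h.lag_five
    rw [h0] at this
    norm_num at this
  have hev : d 0 + d 1 * τ + d 2 * τ ^ 2 + d 3 * τ ^ 3 + d 4 * τ ^ 4 + d 5 * τ ^ 5 ≠ 0 := by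
    intro h0
    have hα := bdf5_eval_neg hτ hτ'
    obtain ⟨e0, e1, e2, e3, e4, e5⟩ := h
    have hprod : (1 - τ ^ 2) * (137 / 60 * τ ^ 5 - 5 * τ ^ 4 + 5 * τ ^ 3 - 10 / 3 * τ ^ 2 +
        5 / 4 * τ - 1 / 5) = 0 := by
      linear_combination 2 * (d 0 * τ ^ 5 + d 1 * τ ^ 4 + d 2 * τ ^ 3 + d 3 * τ ^ 2 + d 4 * τ
        + d 5) * h0 - 2 * τ ^ 5 * e0 - (τ ^ 4 + τ ^ 6) * e1 - (τ ^ 3 + τ ^ 7) * e2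
        - (τ ^ 2 + τ ^ 8) * e3 - (τ + τ ^ 9) * e4 - (1 + τ ^ 10) * e5
    have : 0 < 1 - τ ^ 2 := by nlinarith
    nlinarith
  refine Matrix.PosDef.of_dotProduct_mulVec_pos (by
    rw [Matrix.IsHermitian, Matrix.conjTranspose_eq_transpose_of_trivial]
    exact bdf5G_isSymm τ d) fun x hx => ?_
  rw [star_trivial]
  obtain ⟨a, b, c, e, f, rfl⟩ : ∃ a b c e f, x = ![a, b, c, e, f] :=
    ⟨x 0, x 1, x 2, x 3, x 4, by ext i; fin_cases i <;> rfl⟩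
  have q1 := h.quadForm_eq a b c e f
  have q2 := h.quadForm_eq b c e f (τ * f)
  have q3 := h.quadForm_eq c e f (τ * f) (τ * (τ * f))
  have q4 := h.quadForm_eq e f (τ * f) (τ * (τ * f)) (τ * (τ * (τ * f)))
  have q5 := h.quadForm_eq f (τ * f) (τ * (τ * f)) (τ * (τ * (τ * f))) (τ * (τ * (τ * (τ * f))))
  have hsmul : ![τ * f, τ * (τ * f), τ * (τ * (τ * f)), τ * (τ * (τ * (τ * f))),
      τ * (τ * (τ * (τ * (τ * f))))] =
      τ • ![f, τ * f, τ * (τ * f), τ * (τ * (τ * f)), τ * (τ * (τ * (τ * f)))] := by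
    simp
  rw [hsmul, Matrix.mulVec_smul, smul_dotProduct, dotProduct_smul, smul_eq_mul, smul_eq_mul] at q5
  have hτ2 : 0 < 1 - τ ^ 2 := by nlinarith
  set Q := ![f, τ * f, τ * (τ * f), τ * (τ * (τ * f)), τ * (τ * (τ * (τ * f)))] ⬝ᵥ
    bdf5G τ d *ᵥ ![f, τ * f, τ * (τ * f), τ * (τ * (τ * f)), τ * (τ * (τ * (τ * f)))]
  have hQ : (1 - τ ^ 2) * Q =
      (f * (d 0 + d 1 * τ + d 2 * τ ^ 2 + d 3 * τ ^ 3 + d 4 * τ ^ 4 + d 5 * τ ^ 5)) ^ 2 := by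
    linear_combination q5
  by_cases hf : f = 0
  · have hQ0 : Q = 0 := by
      rw [hf, zero_mul, zero_pow two_ne_zero] at hQ
      exact (mul_eq_zero.mp hQ).resolve_left hτ2.ne'
    rw [q1, q2, q3, q4, hQ0, hf]
    by_contra hneg
    simp only [mul_zero, add_zero, zero_add] at hneg
    obtain ⟨ha, hb, hc, he⟩ := eq_zero_of_sum_sq_nonpos (not_lt.mp hneg)
    obtain rfl : e = 0 := by simpa [hd0] using he
    obtain rfl : c = 0 := by simpa [hd0] using hc
    obtain rfl : b = 0 := by simpa [hd0] using hb
    obtain rfl : a = 0 := by simpa [hd0] using ha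
    exact hx (by ext i; fin_cases i <;> simp [hf])
  · have hQpos : 0 < Q := by
      have : 0 < (1 - τ ^ 2) * Q := by rw [hQ]; positivity
      exact pos_of_mul_pos_right this hτ2.le
    rw [q1, q2, q3, q4]
    positivity

/-- Fejér–Riesz factorization of `a c² + b c + e`, `c = cos θ`, when its discriminant is
nonpositive. -/
theorem exists_quadratic_spectralFactor {a b e : ℝ} (ha : 0 < a) (he : 0 ≤ e)
    (hdisc : b ^ 2 ≤ 4 * a * e) :
    ∃ x y z : ℝ, 4 * (x * z) = a ∧ 2 * (x * y + y * z) = b ∧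
      x ^ 2 + y ^ 2 + z ^ 2 - 2 * (x * z) = e := by
  have hb : |b| ≤ a + e := abs_le_of_sq_le_sq (by nlinarith [sq_nonneg (a - e)]) (by positivity)
  obtain ⟨hb1, hb2⟩ := abs_le.mp hb
  set S := √(a + b + e)
  set D := √(a - b + e)
  have hS : S ^ 2 = a + b + e := Real.sq_sqrt (by linarith)
  have hD : D ^ 2 = a - b + e := Real.sq_sqrt (by linarith)
  have hSD : a - e ≤ S * D := by
    refine (le_abs_self _).trans (abs_le_of_sq_le_sq ?_ (by positivity))
    rw [mul_pow, hS, hD]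
    linarith
  have hT : 0 ≤ ((S + D) / 2) ^ 2 - a := by nlinarith
  set R := √(((S + D) / 2) ^ 2 - a)
  have hR : R ^ 2 = ((S + D) / 2) ^ 2 - a := Real.sq_sqrt hT
  refine ⟨((S + D) / 2 + R) / 2, (S - D) / 2, ((S + D) / 2 - R) / 2, ?_, ?_, ?_⟩
  · linear_combination -hR
  · linear_combination (hS - hD) / 2
  · linear_combination hR + (hS + hD) / 2

/-- The product of `z - 1` with two quadratic spectral factors is a BDF5 spectral factor. -/
theorem exists_isBDF5SpectralFactor_of_factor {τ b e m n : ℝ} (hb : b ^ 2 ≤ 4 * e)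
    (hm : m ^ 2 ≤ 192 * n) (h3 : 48 * b + m = -102 - 24 * τ)
    (h2 : 48 * e + m * b + n = 38 + 51 * τ) (h1 : m * e + n * b = 38 - 25 * τ)
    (h0 : n * e = -22 + 28 * τ) : ∃ d, IsBDF5SpectralFactor τ d := by
  obtain ⟨x, y, z, p2, p1, p0⟩ := exists_quadratic_spectralFactor (a := 1 / 30) (b := b / 30)
    (e := e / 30) (by norm_num) (by nlinarith [sq_nonneg b]) (by nlinarith)
  obtain ⟨r, s, t, q2, q1, q0⟩ := exists_quadratic_spectralFactor (a := 48) (b := m)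
    (e := n) (by norm_num) (by nlinarith [sq_nonneg m]) (by nlinarith)
  have P0 : x ^ 2 + y ^ 2 + z ^ 2 = e / 30 + 1 / 60 := by linear_combination p0 + p2 / 2
  have P1 : x * y + y * z = b / 60 := by linear_combination p1 / 2
  have P2 : x * z = 1 / 120 := by linear_combination p2 / 4
  have Q0 : r ^ 2 + s ^ 2 + t ^ 2 = n + 24 := by linear_combination q0 + q2 / 2
  have Q1 : r * s + s * t = m / 2 := by linear_combination q1 / 2
  have Q2 : r * t = 12 := by linear_combination q2 / 4
  -- autocorrelations of the product of the two quadratics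
  set w0 := x * r
  set w1 := x * s + y * r
  set w2 := x * t + y * s + z * r
  set w3 := y * t + z * s
  set w4 := z * t
  have W0 : w0 ^ 2 + w1 ^ 2 + w2 ^ 2 + w3 ^ 2 + w4 ^ 2 =
      (e / 30 + 1 / 60) * (n + 24) + 2 * (b / 60) * (m / 2) + 2 * (1 / 120) * 12 := by
    rw [← P0, ← P1, ← P2, ← Q0, ← Q1, ← Q2]; ring
  have W1 : w0 * w1 + w1 * w2 + w2 * w3 + w3 * w4 =
      (e / 30 + 1 / 60) * (m / 2) + (b / 60) * (n + 24) + (1 / 120) * (m / 2) + (b / 60) * 12 := by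
    rw [← P0, ← P1, ← P2, ← Q0, ← Q1, ← Q2]; ring
  have W2 : w0 * w2 + w1 * w3 + w2 * w4 =
      (e / 30 + 1 / 60) * 12 + (b / 60) * (m / 2) + (1 / 120) * (n + 24) := by
    rw [← P0, ← P1, ← P2, ← Q0, ← Q1, ← Q2]; ring
  have W3 : w0 * w3 + w1 * w4 = (b / 60) * 12 + (1 / 120) * (m / 2) := by
    rw [← P1, ← P2, ← Q1, ← Q2]; ring
  have W4 : w0 * w4 = (1 / 120) * 12 := by
    rw [← P2, ← Q2]; ring
  clear_value w0 w1 w2 w3 w4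
  refine ⟨![-w0, w0 - w1, w1 - w2, w2 - w3, w3 - w4, w4], ?_⟩
  constructor <;> simp [-mul_neg, -neg_mul]
  · linear_combination 2 * W0 - 2 * W1 + (h0 + h2 / 2) / 15 - (h1 + 3 / 4 * h3) / 30
  · linear_combination 2 * (2 * W1 - W0 - W2) +
      (2 * (h1 / 2 + 3 / 8 * h3) - (h0 + h2 / 2) - h2 / 4) / 15
  · linear_combination 2 * (2 * W2 - W1 - W3) +
      (2 * (h2 / 4) - (h1 / 2 + 3 / 8 * h3) - h3 / 8) / 15
  · linear_combination 2 * (2 * W3 - W2 - W4) +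
      (2 * (h3 / 8) - h2 / 4) / 15
  · linear_combination 2 * (2 * W4 - W3) +
      (- h3 / 8) / 15
  · linear_combination -2 * W4

theorem exists_isBDF5SpectralFactor :
    ∃ τ : ℝ, 4 / 5 < τ ∧ τ < 1 ∧ ∃ d, IsBDF5SpectralFactor τ d := by
  -- the quartic is divisible by `c² + 2 / 11 c + e` for a root `e` of a resultant
  let A0 : ℝ → ℝ := fun e => -(1218 / 11) * e + 2 / 11 * (7034 / 121 - 48 * e) - 38
  let A1 : ℝ → ℝ := fun e => -24 * e + 2 / 11 * (609 / 11) + 25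
  let B0 : ℝ → ℝ := fun e => (7034 / 121 - 48 * e) * e + 22
  let B1 : ℝ → ℝ := fun e => 609 / 11 * e - 28
  have hcont : Continuous fun e => A0 e * B1 e - A1 e * B0 e := by fun_prop
  obtain ⟨e, ⟨he1, he2⟩, he⟩ := intermediate_value_Icc (a := (1 / 80 : ℝ)) (b := 63 / 5000)
    (by norm_num) hcont.continuousOn (show (0 : ℝ) ∈ _ by
      constructor <;> norm_num [A0, A1, B0, B1])
  simp only [A0, A1, B0, B1] at he
  have hB : 0 < 28 - 609 / 11 * e := by linarith
  obtain ⟨τ, hτ⟩ : ∃ τ, τ * (28 - 609 / 11 * e) = (7034 / 121 - 48 * e) * e + 22 :=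
    ⟨_, div_mul_cancel₀ _ hB.ne'⟩
  have hτ1 : 4 / 5 < τ := by
    by_contra! hle
    nlinarith
  have hτ2 : τ < 1 := by
    by_contra! hle
    nlinarith
  refine ⟨τ, hτ1, hτ2, exists_isBDF5SpectralFactor_of_factor (b := 2 / 11) (e := e)
    (m := -(1218 / 11) - 24 * τ) (n := 7034 / 121 - 48 * e + 609 / 11 * τ) ?_ ?_ ?_ ?_ ?_ ?_⟩
  · linarith
  · nlinarith
  · ring
  · ring
  · refine mul_right_cancel₀ hB.ne' ?_
    linear_combination (-24 * e + 2 / 11 * (609 / 11) + 25) * hτ - he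
  · linear_combination -hτ

/-- Nevanlinna–Odeh G-stability for BDF5 (Lemma 1, k = 5): there exist
`0 ≤ τ < 1`, a symmetric positive definite 5×5 matrix `G` and reals
`δ₀,…,δ₅` such that the pairing of the BDF5 difference with `v₅ − τ v₄`
telescopes as a quadratic form plus a nonnegative remainder. -/
theorem bdf5_gstability :
    ∃ (τ : ℝ) (G : Matrix (Fin 5) (Fin 5) ℝ) (d : Fin 6 → ℝ),
      0 ≤ τ ∧ τ < 1 ∧ G.IsSymm ∧ G.PosDef ∧
      ∀ (H : Type) (_ : NormedAddCommGroup H), ∀ (_ : InnerProductSpace ℝ H),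
        ∀ v : Fin 6 → H,
        ⟪(137 / 60 : ℝ) • v 5 - (5 : ℝ) • v 4 + (5 : ℝ) • v 3 - (10 / 3 : ℝ) • v 2 +
            (5 / 4 : ℝ) • v 1 - (1 / 5 : ℝ) • v 0, v 5 - τ • v 4⟫ =
          (∑ i : Fin 5, ∑ j : Fin 5, G i j * ⟪v i.succ, v j.succ⟫) -
            (∑ i : Fin 5, ∑ j : Fin 5, G i j * ⟪v i.castSucc, v j.castSucc⟫) +
            ‖∑ i : Fin 6, d i • v i‖ ^ 2 := by
  obtain ⟨τ, hτ, hτ', d, hd⟩ := exists_isBDF5SpectralFactor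
  exact ⟨τ, bdf5G τ d, d, by linarith, hτ', bdf5G_isSymm τ d, hd.posDef (by linarith) hτ',
    fun H _ _ v => hd.inner_eq v⟩
end

section
/- Let f : ℝ → ℝ be four times continuously differentiable, t ∈ ℝ and h > 0. Then (11/6)·f(t+h) − 3·f(t) + (3/2)·f(t−h) − (1/3)·f(t−2h) − h·f′(t+h) = (1/2)·∫_{t}^{t+h} (t − s)³·f⁗(s) ds − (1/4)·∫_{t−h}^{t+h} (t − h − s)³·f⁗(s) ds + (1/18)·∫_{t−2h}^{t+h} (t − 2h − s)³·f⁗(s) ds. -/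
/-- Cubic Taylor expansion around `b`, with the integral remainder written on the left. -/
theorem integral_cube_mul_iteratedDeriv_four {f : ℝ → ℝ} (hf : ContDiff ℝ 4 f) (x b : ℝ) :
    ∫ s in x..b, (x - s) ^ 3 * iteratedDeriv 4 f s =
      6 * f b + 6 * (x - b) * deriv f b + 3 * (x - b) ^ 2 * iteratedDeriv 2 f b +
        (x - b) ^ 3 * iteratedDeriv 3 f b - 6 * f x := by
  have hd (k : ℕ) (hk : k < 4) (s : ℝ) :
      HasDerivAt (iteratedDeriv k f) (iteratedDeriv (k + 1) f s) s := by
    rw [iteratedDeriv_succ]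
    exact (hf.differentiable_iteratedDeriv k (by exact_mod_cast hk) s).hasDerivAt
  have hprim (s : ℝ) : HasDerivAt
      (fun s => 6 * iteratedDeriv 0 f s + 6 * (x - s) * iteratedDeriv 1 f s +
        3 * (x - s) ^ 2 * iteratedDeriv 2 f s + (x - s) ^ 3 * iteratedDeriv 3 f s)
      ((x - s) ^ 3 * iteratedDeriv 4 f s) s := by
    have hx : HasDerivAt (fun s => x - s) (-1) s := (hasDerivAt_id s).const_sub x
    refine (((((hd 0 (by norm_num) s).const_mul 6).add
      ((hx.const_mul 6).mul (hd 1 (by norm_num) s))).add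
      (((hx.pow 2).const_mul 3).mul (hd 2 (by norm_num) s))).add
      ((hx.pow 3).mul (hd 3 (by norm_num) s))).congr_deriv ?_
    norm_num
    ring
  have hcont : Continuous fun s => (x - s) ^ 3 * iteratedDeriv 4 f s :=
    ((continuous_const.sub continuous_id).pow 3).mul (hf.continuous_iteratedDeriv 4 le_rfl)
  rw [intervalIntegral.integral_eq_sub_of_hasDerivAt (fun s _ => hprim s)
    (hcont.intervalIntegrable x b)]
  simp only [iteratedDeriv_zero, iteratedDeriv_one]
  ring

/-- Integral representation of the BDF3 truncation error
`R₃ = −α₃ f(t+h) + A₃(f(t)) + h f′(t+h)` via Taylor expansion with integral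
remainder around `t + h`. -/
theorem bdf3_truncation_integral_representation
    (f : ℝ → ℝ) (hf : ContDiff ℝ 4 f) (t h : ℝ) (hh : 0 < h) :
    (11 / 6) * f (t + h) - 3 * f t + (3 / 2) * f (t - h) - (1 / 3) * f (t - 2 * h) -
        h * deriv f (t + h) =
      (1 / 2) * (∫ s in t..(t + h), (t - s) ^ 3 * iteratedDeriv 4 f s) -
        (1 / 4) * (∫ s in (t - h)..(t + h), (t - h - s) ^ 3 * iteratedDeriv 4 f s) +
        (1 / 18) * ∫ s in (t - 2 * h)..(t + h), (t - 2 * h - s) ^ 3 * iteratedDeriv 4 f s := by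
  simp only [integral_cube_mul_iteratedDeriv_four hf]
  ring
end
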